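/- There exist real numbers α and β such that liminf_{q→∞} (q·(log₂ q)²)·‖αq‖·‖βq‖ > 0, where the liminf is taken over positive integers q. -/

import Mathlib

/-- Distance from a real number to the nearest integer. -/
noncomputable def nint (t : ℝ) : ℝ := |t - round t|

open MeasureTheory Set

lemma nint_nonneg (t : ℝ) : 0 ≤ nint t := abs_nonneg _

lemma nint_le_half (t : ℝ) : nint t ≤ 1 / 2 := abs_sub_round t

lemma nint_le_abs_sub_intCast (t : ℝ) (m : ℤ) : nint t ≤ |t - m| := round_le t m

lemma nint_le_nint_add_abs_sub (s t : ℝ) : nint s ≤ nint t + |s - t| :=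
  calc nint s ≤ |s - round t| := nint_le_abs_sub_intCast s _
    _ = |(t - round t) + (s - t)| := by ring_nf
    _ ≤ nint t + |s - t| := abs_add_le _ _

/-- The part of an interval of length `l` on which `x * q` is within `δ` of an integer is small. -/
lemma volume_Ico_inter_nint_lt_le (a : ℝ) {l δ : ℝ} (hl : 0 ≤ l) (hδ : 0 ≤ δ) {q : ℕ}
    (hq : 0 < q) :
    volume (Ico a (a + l) ∩ {x : ℝ | nint (x * q) < δ}) ≤
      ENNReal.ofReal ((q * l + 2) * (2 * δ / q)) := by
  have hq' : (0 : ℝ) < q := by exact_mod_cast hq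
  set P := Finset.Icc (round (a * q)) (round ((a + l) * q)) with hP
  have hsub : Ico a (a + l) ∩ {x : ℝ | nint (x * q) < δ} ⊆
      ⋃ p ∈ P, Ioo (((p : ℝ) - δ) / q) ((p + δ) / q) := by
    rintro x ⟨⟨hx1, hx2⟩, hx⟩
    simp only [mem_iUnion, exists_prop]
    refine ⟨round (x * q), ?_, ?_⟩
    · rw [hP, Finset.mem_Icc]
      simp only [round_eq]
      constructor <;> apply Int.floor_mono <;> gcongr
    · have := abs_lt.mp (show |x * q - round (x * q)| < δ from hx)
      constructor
      · rw [div_lt_iff₀ hq']; linarith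
      · rw [lt_div_iff₀ hq']; linarith
  have hcard : (P.card : ℝ) ≤ q * l + 2 := by
    have h1 := abs_le.mp (abs_sub_round (a * q))
    have h2 := abs_le.mp (abs_sub_round ((a + l) * q))
    have h3 : (P.card : ℤ) = max (round ((a + l) * q) + 1 - round (a * q)) 0 := by
      rw [hP, Int.card_Icc, Int.toNat_eq_max]
    have h4 : (P.card : ℝ) = max ((round ((a + l) * q) : ℝ) + 1 - round (a * q)) 0 := by
      exact_mod_cast h3
    rw [h4]
    refine max_le (by linarith) (by positivity)
  calc volume (Ico a (a + l) ∩ {x : ℝ | nint (x * q) < δ})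
      ≤ volume (⋃ p ∈ P, Ioo (((p : ℝ) - δ) / q) ((p + δ) / q)) := measure_mono hsub
    _ ≤ ∑ p ∈ P, volume (Ioo (((p : ℝ) - δ) / q) ((p + δ) / q)) := measure_biUnion_finset_le _ _
    _ = ∑ p ∈ P, ENNReal.ofReal (2 * δ / q) := by
        refine Finset.sum_congr rfl fun p _ => ?_
        rw [Real.volume_Ioo]; congr 1; ring
    _ = ENNReal.ofReal (P.card * (2 * δ / q)) := by
        rw [Finset.sum_const, nsmul_eq_mul, ENNReal.ofReal_mul (by positivity),
          ENNReal.ofReal_natCast]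
    _ ≤ _ := by gcongr

/-- Averaging over the subdivision of an interval into `R` equal parts. -/
lemma exists_subinterval_measure_lt (μ : Measure ℝ) (a : ℝ) {l : ℝ} (hl : 0 < l) {R : ℕ}
    (hR : 0 < R) (hμ : μ (Ico a (a + l)) < ENNReal.ofReal l) :
    ∃ b, a ≤ b ∧ b + l / R ≤ a + l ∧ μ (Ico b (b + l / R)) < ENNReal.ofReal (l / R) := by
  have hR' : (0 : ℝ) < R := by exact_mod_cast hR
  by_contra! hcon
  set f : ℕ → ℝ := fun m => a + m * (l / R) with hf
  have hmono : Monotone f := by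
    intro m n hmn
    simp only [hf]
    gcongr
  have hU : (⋃ m ∈ Finset.range R, Ico (f m) (f (m + 1))) ⊆ Ico a (a + l) := by
    refine iUnion₂_subset fun m hm => Ico_subset_Ico ?_ ?_
    · simp only [hf]; have : 0 ≤ (m : ℝ) * (l / R) := by positivity
      linarith
    · have : f (m + 1) ≤ f R := hmono (Finset.mem_range.mp hm)
      refine this.trans_eq ?_
      simp only [hf]; field_simp
  have hdisj : Pairwise (Function.onFun Disjoint fun m => Ico (f m) (f (m + 1))) :=
    hmono.pairwise_disjoint_on_Ico_succ
  refine absurd hμ (not_lt.mpr ?_)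
  calc ENNReal.ofReal l = ∑ m ∈ Finset.range R, ENNReal.ofReal (l / R) := by
        rw [Finset.sum_const, nsmul_eq_mul, Finset.card_range, ← ENNReal.ofReal_natCast,
          ← ENNReal.ofReal_mul (by positivity)]
        congr 1; field_simp
    _ ≤ ∑ m ∈ Finset.range R, μ (Ico (f m) (f (m + 1))) := by
        refine Finset.sum_le_sum fun m hm => ?_
        have h1 : f (m + 1) = f m + l / R := by simp only [hf]; push_cast; ring
        have h2 : f (m + 1) ≤ f R := hmono (Finset.mem_range.mp hm)
        have h3 : f R = a + l := by simp only [hf]; field_simp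
        have h4 : f 0 ≤ f m := hmono (Nat.zero_le m)
        have h5 : f 0 = a := by simp [hf]
        rw [h1]
        exact hcon _ (by linarith) (by linarith)
    _ = μ (⋃ m ∈ Finset.range R, Ico (f m) (f (m + 1))) :=
        (measure_biUnion_finset (fun i _ j _ hij => hdisj hij) fun _ _ => measurableSet_Ico).symm
    _ ≤ μ (Ico a (a + l)) := measure_mono hU

/-- One step of the nested construction: from an interval of which at least half avoids `G`, pass to
a subinterval that is not contained in `G` and of which at least half avoids `H`. -/
lemma exists_subinterval_not_subset {G H : Set ℝ} (a : ℝ) {l : ℝ} (hl : 0 < l) {R : ℕ}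
    (hR : 0 < R) (hG : volume (Ico a (a + l) ∩ G) ≤ ENNReal.ofReal (l / 2))
    (hH : volume (Ico a (a + l) ∩ H) < ENNReal.ofReal (l / 4)) :
    ∃ b, a ≤ b ∧ b + l / R ≤ a + l ∧ (∃ x ∈ Ico b (b + l / R), x ∉ G) ∧
      volume (Ico b (b + l / R) ∩ H) ≤ ENNReal.ofReal (l / R / 2) := by
  set μ : Measure ℝ := volume.restrict G + (2 : ENNReal) • volume.restrict H with hμ
  have hμI : ∀ u v : ℝ, μ (Ico u v) = volume (Ico u v ∩ G) + 2 * volume (Ico u v ∩ H) := by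
    intro u v
    simp [hμ, Measure.restrict_apply measurableSet_Ico]
  have hlt : μ (Ico a (a + l)) < ENNReal.ofReal l := by
    rw [hμI]
    have h2 : ENNReal.ofReal l = ENNReal.ofReal (l / 2) + 2 * ENNReal.ofReal (l / 4) := by
      rw [show (2 : ENNReal) = ENNReal.ofReal 2 by simp, ← ENNReal.ofReal_mul (by norm_num),
        ← ENNReal.ofReal_add (by positivity) (by positivity)]
      congr 1; ring
    rw [h2]
    refine ENNReal.add_lt_add_of_le_of_lt (ne_top_of_le_ne_top ENNReal.ofReal_ne_top hG) hG ?_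
    exact ENNReal.mul_lt_mul_right (by simp) (by simp) hH
  obtain ⟨b, hab, hbl, hb⟩ := exists_subinterval_measure_lt μ a hl hR hlt
  have hR' : (0 : ℝ) < R := by exact_mod_cast hR
  rw [hμI] at hb
  refine ⟨b, hab, hbl, ?_, ?_⟩
  · by_contra! hcon
    have h1 : Ico b (b + l / R) ∩ G = Ico b (b + l / R) := inter_eq_left.mpr hcon
    rw [h1, Real.volume_Ico, add_sub_cancel_left] at hb
    exact absurd hb (not_lt.mpr le_self_add)
  · have h3 : 2 * volume (Ico b (b + l / R) ∩ H) ≤ 2 * ENNReal.ofReal (l / R / 2) := by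
      refine (le_add_self.trans hb.le).trans_eq ?_
      rw [show (2 : ENNReal) = ENNReal.ofReal 2 by simp, ← ENNReal.ofReal_mul (by norm_num)]
      congr 1; ring
    exact (ENNReal.mul_le_mul_iff_right (by simp) (by simp)).mp h3

/-- Points close to an integer multiple of `1 / q` for some `q` in a range. -/
def nearRational (Δ : ℕ → ℝ) (s t : ℕ) : Set ℝ :=
  ⋃ q ∈ Finset.Ico s t, {x : ℝ | nint (x * q) < 2 * Δ q}

lemma volume_Ico_inter_nearRational_lt {Δ : ℕ → ℝ} (hΔ : ∀ q, 0 ≤ Δ q) {s t : ℕ} (hs : 0 < s)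
    (hsum : ∑ q ∈ Finset.Ico s t, Δ q < 1 / 48) (a : ℝ) {l : ℝ} (hl : 0 < l) (hsl : 1 ≤ s * l) :
    volume (Ico a (a + l) ∩ nearRational Δ s t) < ENNReal.ofReal (l / 4) := by
  rw [nearRational, inter_iUnion₂]
  calc volume (⋃ q ∈ Finset.Ico s t, Ico a (a + l) ∩ {x : ℝ | nint (x * q) < 2 * Δ q})
      ≤ ∑ q ∈ Finset.Ico s t, volume (Ico a (a + l) ∩ {x : ℝ | nint (x * q) < 2 * Δ q}) :=
        measure_biUnion_finset_le _ _
    _ ≤ ∑ q ∈ Finset.Ico s t, ENNReal.ofReal (12 * l * Δ q) := by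
        refine Finset.sum_le_sum fun q hq => ?_
        have hsq : s ≤ q := (Finset.mem_Ico.mp hq).1
        have hsq' : (s : ℝ) ≤ q := by exact_mod_cast hsq
        have hq0 : 0 < q := hs.trans_le hsq
        have hq0' : (0 : ℝ) < q := by exact_mod_cast hq0
        have := hΔ q
        refine (volume_Ico_inter_nint_lt_le a hl.le (by positivity) hq0).trans ?_
        apply ENNReal.ofReal_le_ofReal
        have hql : 1 ≤ q * l := hsl.trans (by gcongr)
        calc (q * l + 2) * (2 * (2 * Δ q) / q) ≤ (3 * (q * l)) * (2 * (2 * Δ q) / q) := by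
              gcongr; linarith
          _ = 12 * l * Δ q := by field_simp; ring
    _ = ENNReal.ofReal (12 * l * ∑ q ∈ Finset.Ico s t, Δ q) := by
        rw [Finset.mul_sum, ENNReal.ofReal_sum_of_nonneg]
        intro q _
        have := hΔ q
        positivity
    _ < ENNReal.ofReal (l / 4) := by
        rw [ENNReal.ofReal_lt_ofReal_iff (by positivity)]
        nlinarith

/-- If the sums of `Δ` over the ranges `[N, N ^ 3)`, for `N` in an orbit of the cubing map, are
small, then some `β` satisfies `‖β q‖ ≥ Δ q` for all large `q`. -/
theorem exists_forall_le_nint {Δ : ℕ → ℝ} {N : ℕ → ℕ} (hN0 : 1 < N 0)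
    (hN : ∀ i, N (i + 1) = N i ^ 3) (hΔ : ∀ q : ℕ, 1 / (q : ℝ) ^ 2 ≤ Δ q)
    (hsum : ∀ i, ∑ q ∈ Finset.Ico (N i) (N (i + 1)), Δ q < 1 / 48) :
    ∃ β : ℝ, ∀ q, N 0 ≤ q → Δ q ≤ nint (β * q) := by
  have hΔ0 : ∀ q, 0 ≤ Δ q := fun q => le_trans (by positivity) (hΔ q)
  have hN1 : ∀ i, 1 < N i := by
    intro i
    induction i with
    | zero => exact hN0
    | succ i ih => rw [hN]; exact one_lt_pow₀ ih (by norm_num)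
  have hNpos : ∀ i, (0 : ℝ) < N i := fun i => by exact_mod_cast (zero_lt_one.trans (hN1 i))
  have hNmono : StrictMono N := strictMono_nat_of_lt_succ fun i => by
    rw [hN]; exact lt_self_pow₀ (hN1 i) (by norm_num)
  set G : ℕ → Set ℝ := fun i => nearRational Δ (N i) (N (i + 1)) with hG
  have hsmall : ∀ (i : ℕ) (a : ℝ),
      volume (Ico a (a + 1 / N i) ∩ G i) < ENNReal.ofReal (1 / N i / 4) := by
    intro i a
    refine volume_Ico_inter_nearRational_lt hΔ0 (zero_lt_one.trans (hN1 i)) (hsum i) a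
      (by have := hNpos i; positivity) ?_
    rw [mul_one_div_cancel (hNpos i).ne']
  have hstart : ∃ a : ℝ, volume (Ico a (a + 1 / N 1) ∩ G 0) ≤ ENNReal.ofReal (1 / N 1 / 2) := by
    obtain ⟨b, -, -, -, hb⟩ := exists_subinterval_not_subset (G := ∅) (H := G 0) 0
      (l := 1 / N 0) (by have := hNpos 0; positivity) (R := N 0 ^ 2) (by have := hN1 0; positivity)
      (by simp) (hsmall 0 0)
    have hlen : (1 : ℝ) / N 0 / (N 0 ^ 2 : ℕ) = 1 / N 1 := by
      rw [hN]; push_cast; field_simp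
    rw [hlen] at hb
    exact ⟨b, hb⟩
  have hstep : ∀ (i : ℕ) (a : ℝ), volume (Ico a (a + 1 / N (i + 1)) ∩ G i) ≤
      ENNReal.ofReal (1 / N (i + 1) / 2) → ∃ b, a ≤ b ∧
        b + 1 / N (i + 2) ≤ a + 1 / N (i + 1) ∧
        (∃ x ∈ Ico b (b + 1 / N (i + 2)), x ∉ G i) ∧
        volume (Ico b (b + 1 / N (i + 2)) ∩ G (i + 1)) ≤
          ENNReal.ofReal (1 / N (i + 2) / 2) := by
    intro i a ha
    have hlen : (1 : ℝ) / N (i + 1) / (N (i + 1) ^ 2 : ℕ) = 1 / N (i + 2) := by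
      rw [hN (i + 1)]; push_cast; field_simp
    have := exists_subinterval_not_subset (H := G (i + 1)) a
      (l := 1 / N (i + 1)) (by have := hNpos (i + 1); positivity) (R := N (i + 1) ^ 2)
      (by have := hN1 (i + 1); positivity) ha (hsmall (i + 1) a)
    rwa [hlen] at this
  obtain ⟨a₀, ha₀⟩ := hstart
  choose! nxt hn1 hn2 hn3 hn4 using hstep
  let u : ℕ → ℝ := fun i => Nat.rec a₀ (fun i a => nxt i a) i
  have hu : ∀ i, volume (Ico (u i) (u i + 1 / N (i + 1)) ∩ G i) ≤
      ENNReal.ofReal (1 / N (i + 1) / 2) := by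
    intro i
    induction i with
    | zero => exact ha₀
    | succ i ih => exact hn4 i _ ih
  have hanti : Antitone fun i => Icc (u i) (u i + 1 / N (i + 1)) :=
    antitone_nat_of_succ_le fun i => Icc_subset_Icc (hn1 i _ (hu i)) (hn2 i _ (hu i))
  have hmem := ciSup_mem_iInter_Icc_of_antitone_Icc hanti
    (fun i => by have := hNpos (i + 1); simp)
  set β := ⨆ n, u n
  refine ⟨β, fun q hq => ?_⟩
  obtain ⟨i, hi1, hi2⟩ : ∃ i, N i ≤ q ∧ q < N (i + 1) := by
    have hex : ∃ i, q < N i := ⟨q + 1, (Nat.lt_succ_self q).trans_le hNmono.le_apply⟩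
    obtain ⟨j, hj⟩ : ∃ j, Nat.find hex = j + 1 := Nat.exists_eq_succ_of_ne_zero fun h0 => by
      have := Nat.find_spec hex
      rw [h0] at this
      omega
    refine ⟨j, ?_, ?_⟩
    · exact not_lt.mp (Nat.find_min hex (by omega))
    · rw [← hj]; exact Nat.find_spec hex
  have hqpos : (0 : ℝ) < q := (hNpos i).trans_le (by exact_mod_cast hi1)
  obtain ⟨x, hx, hxG⟩ := hn3 i _ (hu i)
  have hβ : β ∈ Icc (u (i + 1)) (u (i + 1) + 1 / N (i + 2)) := mem_iInter.mp hmem (i + 1)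
  have hxq : 2 * Δ q ≤ nint (x * q) := by
    by_contra! hcon
    exact hxG (mem_iUnion₂.mpr ⟨q, Finset.mem_Ico.mpr ⟨hi1, hi2⟩, hcon⟩)
  have hdist : |x * q - β * q| ≤ Δ q := by
    have h1 : |x - β| ≤ 1 / N (i + 2) := by
      have hx1 : u (i + 1) ≤ x := hx.1
      have hx2 : x < u (i + 1) + 1 / N (i + 2) := hx.2
      rw [abs_le]; constructor <;> linarith [hβ.1, hβ.2]
    rw [← sub_mul, abs_mul, abs_of_pos hqpos]
    have hqN : (q : ℝ) ≤ N (i + 1) := by exact_mod_cast hi2.le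
    calc |x - β| * q ≤ 1 / N (i + 2) * q := by gcongr
      _ = q / (N (i + 1) : ℝ) ^ 3 := by rw [hN (i + 1)]; push_cast; ring
      _ ≤ q / (q : ℝ) ^ 3 := by gcongr
      _ = 1 / (q : ℝ) ^ 2 := by field_simp
      _ ≤ Δ q := hΔ q
  linarith [nint_le_nint_add_abs_sub (x * q) (β * q)]

lemma nint_eq_abs_sub_intCast {t : ℝ} {m : ℤ} (h : |t - m| ≤ 1 / 2) : nint t = |t - m| := by
  refine le_antisymm (nint_le_abs_sub_intCast t m) ?_
  by_cases hm : round t = m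
  · rw [nint, hm]
  · have h1 : (1 : ℝ) ≤ |(round t : ℝ) - m| := by
      exact_mod_cast Int.one_le_abs (sub_ne_zero.mpr hm)
    have h2 : |(round t : ℝ) - m| ≤ |t - round t| + |t - m| := by
      rw [abs_sub_comm t (round t)]; exact abs_sub_le _ _ _
    rw [nint]; linarith

lemma sum_inv_le_of_separated {T : Finset ℕ} {y : ℕ → ℝ} {δ μ : ℝ} {M : ℕ} (hδ : 0 < δ) (hμ : 0 < μ)
    (hM : 1 ≤ 2 * δ * M) (hy : ∀ r ∈ T, μ ≤ y r) (hy' : ∀ r ∈ T, y r ≤ 1 / 2)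
    (hsep : ∀ r ∈ T, ∀ s ∈ T, r ≠ s → δ ≤ |y r - y s|) :
    ∑ r ∈ T, 1 / y r ≤ 1 / μ + 1 / δ * (1 + Real.log M) := by
  set g : ℕ → ℝ := fun m => if m = 0 then 1 / μ else 1 / δ * (m : ℝ)⁻¹ with hg
  have hg0 : ∀ m, 0 ≤ g m := fun m => by
    simp only [hg]; split_ifs <;> positivity
  have hinj : Set.InjOn (fun r => ⌊y r / δ⌋₊) T := by
    intro r hr s hs hrs
    by_contra hne
    have h1 := hsep r hr s hs hne
    have hyr := hμ.trans_le (hy r hr)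
    have hys := hμ.trans_le (hy s hs)
    have hrs' : ⌊y r / δ⌋₊ = ⌊y s / δ⌋₊ := hrs
    have hr1 := Nat.floor_le (show 0 ≤ y r / δ by positivity)
    have hr2 := Nat.lt_floor_add_one (y r / δ)
    have hs1 := Nat.floor_le (show 0 ≤ y s / δ by positivity)
    have hs2 := Nat.lt_floor_add_one (y s / δ)
    rw [hrs'] at hr1 hr2
    have h2 : |y r / δ - y s / δ| < 1 := abs_lt.mpr ⟨by linarith, by linarith⟩
    rw [← sub_div, abs_div, abs_of_pos hδ, div_lt_one hδ] at h2
    linarith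
  calc ∑ r ∈ T, 1 / y r ≤ ∑ r ∈ T, g ⌊y r / δ⌋₊ := by
        refine Finset.sum_le_sum fun r hr => ?_
        have hyr := hμ.trans_le (hy r hr)
        simp only [hg]
        split_ifs with h0
        · exact one_div_le_one_div_of_le hμ (hy r hr)
        · have hfl := Nat.floor_le (show 0 ≤ y r / δ by positivity)
          have hpos : (0 : ℝ) < ⌊y r / δ⌋₊ := by exact_mod_cast Nat.pos_of_ne_zero h0
          rw [le_div_iff₀ hδ] at hfl
          rw [← one_div, one_div_mul_one_div]
          apply one_div_le_one_div_of_le (by positivity)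
          linarith
    _ = ∑ m ∈ T.image fun r => ⌊y r / δ⌋₊, g m := (Finset.sum_image hinj).symm
    _ ≤ ∑ m ∈ Finset.range (M + 1), g m := by
        refine Finset.sum_le_sum_of_subset_of_nonneg ?_ fun m _ _ => hg0 m
        intro m hm
        obtain ⟨r, hr, rfl⟩ := Finset.mem_image.mp hm
        rw [Finset.mem_range, Nat.lt_succ_iff]
        apply Nat.floor_le_of_le
        rw [div_le_iff₀ hδ]
        linarith [hy' r hr]
    _ = 1 / μ + 1 / δ * (harmonic M : ℚ) := by
        rw [Finset.sum_range_succ', add_comm, harmonic]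
        push_cast
        rw [Finset.mul_sum]
        simp [hg]
    _ ≤ _ := by
        gcongr
        exact harmonic_le_one_add_log M

/-- The sum of the inverse distances to the nearest integer of points that are `δ`-separated
modulo one and at distance at least `μ` from the integers. -/
lemma sum_inv_nint_le {S : Finset ℕ} {x : ℕ → ℝ} {δ μ : ℝ} {M : ℕ} (hδ : 0 < δ) (hμ : 0 < μ)
    (hM : 1 ≤ 2 * δ * M) (hx : ∀ r ∈ S, μ ≤ nint (x r))
    (hsep : ∀ r ∈ S, ∀ s ∈ S, r ≠ s → δ ≤ nint (x r - x s)) :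
    ∑ r ∈ S, 1 / nint (x r) ≤ 2 * (1 / μ + 1 / δ * (1 + Real.log M)) := by
  rw [← Finset.sum_filter_add_sum_filter_not S (fun r => 0 ≤ x r - round (x r)), two_mul]
  refine add_le_add ?_ ?_
  all_goals
    refine sum_inv_le_of_separated (y := fun r => nint (x r)) hδ hμ hM
      (fun r hr => hx r (Finset.mem_filter.mp hr).1) (fun r _ => nint_le_half _) ?_
    intro r hr s hs hrs
    rw [Finset.mem_filter] at hr hs
    refine (hsep r hr.1 s hs.1 hrs).trans ?_
    refine (nint_le_abs_sub_intCast _ (round (x r) - round (x s))).trans_eq ?_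
  · rw [nint, nint, abs_of_nonneg hr.2, abs_of_nonneg hs.2]
    push_cast; congr 1; ring
  · rw [nint, nint, abs_of_neg (not_le.mp hr.2), abs_of_neg (not_le.mp hs.2), ← abs_neg]
    push_cast; congr 1; ring

/-- Denominators of the convergents of the continued fraction `[0; 2, a 0, a 1, …]`, starting
with those of `0` and `1 / 2`. -/
def cfDen (a : ℕ → ℕ) : ℕ → ℕ
  | 0 => 1
  | 1 => 2
  | n + 2 => a n * cfDen a (n + 1) + cfDen a n

/-- Numerators of the convergents of the continued fraction `[0; 2, a 0, a 1, …]`, starting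
with those of `0` and `1 / 2`. -/
def cfNum (a : ℕ → ℕ) : ℕ → ℤ
  | 0 => 0
  | 1 => 1
  | n + 2 => a n * cfNum a (n + 1) + cfNum a n

section ContinuedFraction

variable {a : ℕ → ℕ}

lemma cfDen_add_two (n : ℕ) : cfDen a (n + 2) = a n * cfDen a (n + 1) + cfDen a n := rfl

lemma cfNum_add_two (n : ℕ) : cfNum a (n + 2) = a n * cfNum a (n + 1) + cfNum a n := rfl

lemma cfDen_pos (n : ℕ) : 0 < cfDen a n := by
  induction n using Nat.twoStepInduction with
  | zero => simp [cfDen]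
  | one => simp [cfDen]
  | more n h1 h2 => rw [cfDen_add_two]; omega

lemma cfDen_strictMono (ha : ∀ n, 1 ≤ a n) : StrictMono (cfDen a) := by
  refine strictMono_nat_of_lt_succ fun n => ?_
  cases n with
  | zero => simp [cfDen]
  | succ n =>
    have := cfDen_pos (a := a) n
    have := Nat.mul_le_mul_right (cfDen a (n + 1)) (ha n)
    rw [cfDen_add_two]
    omega

lemma cf_det (n : ℕ) :
    cfNum a (n + 1) * cfDen a n - cfNum a n * cfDen a (n + 1) = (-1) ^ n := by
  induction n with
  | zero => simp [cfDen, cfNum]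
  | succ n ih =>
    rw [cfNum_add_two, cfDen_add_two, pow_succ, ← ih]
    push_cast
    ring

/-- There is a real number lying between consecutive convergents. -/
lemma exists_between_convergents (a : ℕ → ℕ) :
    ∃ α : ℝ, ∀ n, 0 ≤ (-1) ^ n * (cfDen a n * α - cfNum a n) := by
  have hpos : ∀ n, (0 : ℝ) < cfDen a n := fun n => by exact_mod_cast cfDen_pos n
  have hdet : ∀ n, (cfNum a (n + 1) * cfDen a n - cfNum a n * cfDen a (n + 1) : ℝ) = (-1) ^ n :=
    fun n => by exact_mod_cast cf_det n
  have hdet' : ∀ n, (cfNum a (n + 2) * cfDen a n - cfNum a n * cfDen a (n + 2) : ℝ) =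
      a n * (-1) ^ n := fun n => by
    rw [← hdet, cfNum_add_two, cfDen_add_two]; push_cast; ring
  set f : ℕ → ℝ := fun n => cfNum a (2 * n) / cfDen a (2 * n) with hf
  set g : ℕ → ℝ := fun n => cfNum a (2 * n + 1) / cfDen a (2 * n + 1) with hg
  have hfg : ∀ n, f n ≤ g n := fun n => by
    simp only [hf, hg]
    rw [div_le_div_iff₀ (hpos _) (hpos _)]
    have := hdet (2 * n)
    rw [pow_mul, neg_one_sq, one_pow] at this
    linarith
  have hanti : Antitone fun n => Set.Icc (f n) (g n) := by
    refine antitone_nat_of_succ_le fun n => Set.Icc_subset_Icc ?_ ?_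
    · simp only [hf]
      rw [div_le_div_iff₀ (hpos _) (hpos _)]
      have := hdet' (2 * n)
      rw [pow_mul, neg_one_sq, one_pow] at this
      have : (0 : ℝ) ≤ a (2 * n) := by positivity
      rw [show 2 * (n + 1) = 2 * n + 2 by ring]
      linarith
    · simp only [hg]
      rw [div_le_div_iff₀ (hpos _) (hpos _)]
      have := hdet' (2 * n + 1)
      rw [pow_succ, pow_mul, neg_one_sq, one_pow] at this
      have : (0 : ℝ) ≤ a (2 * n + 1) := by positivity
      rw [show 2 * (n + 1) + 1 = 2 * n + 1 + 2 by ring]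
      linarith
  have hmem := Set.mem_iInter.mp (ciSup_mem_iInter_Icc_of_antitone_Icc hanti hfg)
  refine ⟨⨆ n, f n, fun n => ?_⟩
  obtain ⟨k, rfl | rfl⟩ := Nat.even_or_odd' n
  · have h1 := (hmem k).1
    simp only [hf] at h1
    rw [div_le_iff₀ (hpos _)] at h1
    rw [pow_mul, neg_one_sq, one_pow]
    linarith
  · have h1 := (hmem k).2
    simp only [hg] at h1
    rw [le_div_iff₀ (hpos _)] at h1
    rw [pow_succ, pow_mul, neg_one_sq, one_pow]
    linarith

/-- The signed error `q α - p` at the `n`-th convergent, normalised to be nonnegative for the value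
of the continued fraction. -/
noncomputable def cfErr (a : ℕ → ℕ) (α : ℝ) (n : ℕ) : ℝ :=
  (-1) ^ n * (cfDen a n * α - cfNum a n)

variable {α : ℝ}

lemma cfErr_eq (n : ℕ) : cfErr a α n = a n * cfErr a α (n + 1) + cfErr a α (n + 2) := by
  simp only [cfErr, cfNum_add_two, cfDen_add_two, pow_succ]
  push_cast
  ring

lemma abs_cfDen_mul_sub_cfNum (hα : ∀ n, 0 ≤ cfErr a α n) (n : ℕ) :
    |α * cfDen a n - cfNum a n| = cfErr a α n := by
  rw [← abs_of_nonneg (hα n), cfErr, abs_mul, abs_pow, abs_neg, abs_one, one_pow, one_mul,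
    mul_comm α]

lemma cfDen_mul_cfErr_add (n : ℕ) :
    cfDen a (n + 1) * cfErr a α n + cfDen a n * cfErr a α (n + 1) = 1 := by
  have hdet : (cfNum a (n + 1) * cfDen a n - cfNum a n * cfDen a (n + 1) : ℝ) = (-1) ^ n := by
    exact_mod_cast cf_det n
  have hsq : ((-1 : ℝ) ^ n) * (-1) ^ n = 1 := by rw [← mul_pow]; simp
  simp only [cfErr, pow_succ]
  calc _ = (-1 : ℝ) ^ n * (cfNum a (n + 1) * cfDen a n - cfNum a n * cfDen a (n + 1)) := by ring
    _ = 1 := by rw [hdet, hsq]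

lemma cfErr_succ_le (ha : ∀ n, 1 ≤ a n) (hα : ∀ n, 0 ≤ cfErr a α n) (n : ℕ) :
    cfErr a α (n + 1) ≤ cfErr a α n := by
  rw [cfErr_eq n]
  have h1 : (1 : ℝ) ≤ a n := by exact_mod_cast ha n
  nlinarith [hα (n + 1), hα (n + 2)]

lemma cfErr_mul_cfDen_le (hα : ∀ n, 0 ≤ cfErr a α n) (n : ℕ) :
    cfErr a α n * cfDen a (n + 1) ≤ 1 := by
  have h1 := cfDen_mul_cfErr_add (a := a) (α := α) n
  have h2 : 0 ≤ cfDen a n * cfErr a α (n + 1) := mul_nonneg (by positivity) (hα _)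
  linarith

lemma one_le_two_mul_cfErr (ha : ∀ n, 1 ≤ a n) (hα : ∀ n, 0 ≤ cfErr a α n) (n : ℕ) :
    1 ≤ 2 * cfErr a α n * cfDen a (n + 1) := by
  have h1 := cfDen_mul_cfErr_add (a := a) (α := α) n
  have h2 : (cfDen a n : ℝ) ≤ cfDen a (n + 1) := by
    exact_mod_cast ((cfDen_strictMono ha).monotone n.le_succ)
  have h3 := cfErr_succ_le ha hα n
  have h4 : cfDen a n * cfErr a α (n + 1) ≤ cfDen a (n + 1) * cfErr a α n := by
    gcongr
    exact hα _
  linarith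

lemma cfErr_pos (ha : ∀ n, 1 ≤ a n) (hα : ∀ n, 0 ≤ cfErr a α n) (n : ℕ) : 0 < cfErr a α n := by
  refine (hα n).lt_of_ne fun h => ?_
  have := one_le_two_mul_cfErr ha hα n
  rw [← h] at this
  norm_num at this

/-- Convergents are best approximations. -/
lemma cfErr_le_nint (hα : ∀ n, 0 ≤ cfErr a α n) {n k : ℕ} (hk : 0 < k)
    (hkn : k < cfDen a (n + 1)) : cfErr a α n ≤ nint (α * k) := by
  set p : ℤ := round (α * k) with hp
  set x : ℤ := (-1) ^ n * (k * cfNum a (n + 1) - p * cfDen a (n + 1)) with hx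
  set y : ℤ := (-1) ^ n * (p * cfDen a n - k * cfNum a n) with hy
  have hsq : ((-1 : ℤ) ^ n) * (-1) ^ n = 1 := by rw [← mul_pow]; simp
  have hdet := cf_det (a := a) n
  have hk' : x * cfDen a n + y * cfDen a (n + 1) = k := by
    calc _ = (-1 : ℤ) ^ n * (cfNum a (n + 1) * cfDen a n - cfNum a n * cfDen a (n + 1)) * k := by
          rw [hx, hy]; ring
      _ = k := by rw [hdet, hsq, one_mul]
  have hp' : x * cfNum a n + y * cfNum a (n + 1) = p := by
    calc _ = (-1 : ℤ) ^ n * (cfNum a (n + 1) * cfDen a n - cfNum a n * cfDen a (n + 1)) * p := by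
          rw [hx, hy]; ring
      _ = p := by rw [hdet, hsq, one_mul]
  have hval : |α * k - p| = |x * cfErr a α n - y * cfErr a α (n + 1)| := by
    have hkR : (x * cfDen a n + y * cfDen a (n + 1) : ℝ) = k := by exact_mod_cast hk'
    have hpR : (x * cfNum a n + y * cfNum a (n + 1) : ℝ) = p := by exact_mod_cast hp'
    have : x * cfErr a α n - y * cfErr a α (n + 1) = (-1) ^ n * (α * k - p) := by
      rw [← hkR, ← hpR]; simp only [cfErr, pow_succ]; ring
    rw [this, abs_mul, abs_pow, abs_neg, abs_one, one_pow, one_mul]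
  have hq0 : (0 : ℤ) < cfDen a n := by exact_mod_cast cfDen_pos n
  have hk0 : (0 : ℤ) < k := by exact_mod_cast hk
  have hkn' : (k : ℤ) < cfDen a (n + 1) := by exact_mod_cast hkn
  have h0 := hα n
  have h1 := hα (n + 1)
  rw [nint, ← hp, hval]
  rcases lt_trichotomy y 0 with hy0 | hy0 | hy0
  · have hx0 : 1 ≤ x := by
      by_contra! hcon
      nlinarith
    have hxR : (1 : ℝ) ≤ x := by exact_mod_cast hx0
    have hyR : (y : ℝ) ≤ 0 := by exact_mod_cast hy0.le
    refine le_trans ?_ (le_abs_self _)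
    nlinarith
  · have hx0 : 1 ≤ x := by
      by_contra! hcon
      rw [hy0] at hk'
      nlinarith
    have hxR : (1 : ℝ) ≤ x := by exact_mod_cast hx0
    have hyR : (y : ℝ) = 0 := by exact_mod_cast hy0
    refine le_trans ?_ (le_abs_self _)
    rw [hyR]
    nlinarith
  · have hx0 : x ≤ -1 := by
      by_contra! hcon
      nlinarith
    have hxR : (x : ℝ) ≤ -1 := by exact_mod_cast hx0
    have hyR : (0 : ℝ) ≤ y := by exact_mod_cast hy0.le
    refine le_trans ?_ (neg_le_abs _)
    nlinarith

lemma sum_Ico_mul_eq_sum_sum {M : Type*} [AddCommMonoid M] (F : ℕ → M) (Q b : ℕ) :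
    ∑ k ∈ Finset.Ico Q ((b + 1) * Q), F k =
      ∑ d ∈ Finset.Icc 1 b, ∑ r ∈ Finset.range Q, F (d * Q + r) := by
  induction b with
  | zero => simp
  | succ b ih =>
    rw [Finset.sum_Icc_succ_top (by omega), ← ih, ← Finset.sum_Ico_consecutive F
      (show Q ≤ (b + 1) * Q by nlinarith) (show (b + 1) * Q ≤ (b + 1 + 1) * Q by nlinarith)]
    congr 1
    rw [Finset.sum_Ico_eq_sum_range, show (b + 1 + 1) * Q - (b + 1) * Q = Q by
      rw [← Nat.sub_mul]; simp]

lemma sum_Ico_inv_sq_le {s : ℕ} (hs : 0 < s) (t : ℕ) :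
    ∑ d ∈ Finset.Ico s t, 1 / (d : ℝ) ^ 2 ≤ 2 / (s : ℝ) := by
  obtain ⟨s, rfl⟩ := Nat.exists_eq_succ_of_ne_zero hs.ne'
  have h : Finset.Ico (s + 1) t = Finset.Ioo s t := by
    ext x; simp only [Finset.mem_Ico, Finset.mem_Ioo]; omega
  have := sum_Ioo_inv_sq_le (α := ℝ) s t
  simpa [h] using this

lemma sum_Icc_inv_sq_le (b : ℕ) : ∑ d ∈ Finset.Icc 1 b, 1 / (d : ℝ) ^ 2 ≤ 2 := by
  have h : Finset.Icc 1 b = Finset.Ico 1 (b + 1) := by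
    ext x; simp only [Finset.mem_Icc, Finset.mem_Ico]; omega
  rw [h]
  simpa using sum_Ico_inv_sq_le one_pos (b + 1)

lemma sum_Icc_inv_le (b : ℕ) : ∑ d ∈ Finset.Icc 1 b, 1 / (d : ℝ) ≤ 1 + Real.log b := by
  refine le_trans (le_of_eq ?_) (harmonic_le_one_add_log b)
  rw [harmonic_eq_sum_Icc]
  push_cast
  simp

/-- The multiples of a convergent denominator below the next one. -/
lemma mul_cfErr_eq_nint (ha : ∀ n, 1 ≤ a n) (hα : ∀ n, 0 ≤ cfErr a α n) {n d : ℕ}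
    (hd : d ≤ a n) :
    nint (α * (d * cfDen a (n + 1) : ℕ)) = d * cfErr a α (n + 1) := by
  have h1 : |α * (d * cfDen a (n + 1) : ℕ) - (d * cfNum a (n + 1) : ℤ)| =
      d * cfErr a α (n + 1) := by
    have h : α * (d * cfDen a (n + 1) : ℕ) - (d * cfNum a (n + 1) : ℤ) =
        d * (α * cfDen a (n + 1) - cfNum a (n + 1)) := by push_cast; ring
    rw [h, abs_mul, Nat.abs_cast, abs_cfDen_mul_sub_cfNum hα]
  rw [nint_eq_abs_sub_intCast _, h1]
  rw [h1]
  have h2 : d * cfErr a α (n + 1) ≤ cfErr a α n := by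
    rw [cfErr_eq n]
    have : (d : ℝ) * cfErr a α (n + 1) ≤ a n * cfErr a α (n + 1) := by
      gcongr
      exact hα _
    linarith [hα (n + 2)]
  have h3 := cfErr_mul_cfDen_le hα n
  have h4 : (2 : ℝ) ≤ cfDen a (n + 1) := by
    have := (cfDen_strictMono ha).monotone (show 1 ≤ n + 1 by omega)
    exact_mod_cast this
  nlinarith [hα n]

/-- The terms of a block in which the quotient by the convergent denominator is `d`. -/
lemma sum_block_row_le (ha : ∀ n, 1 ≤ a n) (hα : ∀ n, 0 ≤ cfErr a α n) {n d : ℕ} (hd : 1 ≤ d)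
    (hda : d ≤ a n) :
    ∑ r ∈ Finset.range (cfDen a (n + 1)),
      (if d * cfDen a (n + 1) + r < cfDen a (n + 2) then
        1 / (((d * cfDen a (n + 1) + r : ℕ) : ℝ) * nint (α * (d * cfDen a (n + 1) + r : ℕ)))
        else 0) ≤
      1 / (cfDen a (n + 1) * cfErr a α (n + 1)) * (1 / (d : ℝ) ^ 2) + 24 +
        4 * (1 + Real.log (cfDen a (n + 1))) * (1 / d) := by
  set Q := cfDen a (n + 1) with hQ
  have hQpos : 0 < Q := cfDen_pos _
  have hQR : (0 : ℝ) < Q := by exact_mod_cast hQpos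
  have hdR : (1 : ℝ) ≤ d := by exact_mod_cast hd
  have hdaR : (d : ℝ) ≤ a n := by exact_mod_cast hda
  have hδ := cfErr_pos ha hα n
  have hε := cfErr_pos ha hα (n + 1)
  have hM : 1 ≤ 2 * cfErr a α n * Q := one_le_two_mul_cfErr ha hα n
  have hlog : 0 ≤ Real.log Q := Real.log_natCast_nonneg Q
  set S := (Finset.range (Q - 1)).filter fun r => d * Q + (r + 1) < cfDen a (n + 2) with hS
  obtain ⟨μ, hμ, hμle, hμS⟩ : ∃ μ : ℝ, 0 < μ ∧ 1 / μ ≤ 4 * Q + 8 * (d * Q) ∧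
      ∀ r ∈ S, μ ≤ nint (α * (d * Q + (r + 1) : ℕ)) := by
    by_cases h2d : 2 * d ≤ a n
    · refine ⟨cfErr a α n / 2, by positivity, ?_, ?_⟩
      · have : 1 / (cfErr a α n / 2) ≤ 4 * Q := by
          rw [div_le_iff₀ (by positivity)]; linarith
        have : 0 ≤ 8 * ((d : ℝ) * Q) := by positivity
        linarith
      · intro r hr
        rw [hS, Finset.mem_filter, Finset.mem_range] at hr
        have h1 : cfErr a α n ≤ nint (α * (r + 1 : ℕ)) :=
          cfErr_le_nint hα (Nat.succ_pos r) (by omega)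
        have h2 : nint (α * (r + 1 : ℕ)) ≤
            nint (α * (d * Q + (r + 1) : ℕ)) + d * cfErr a α (n + 1) := by
          refine (nint_le_abs_sub_intCast _
            (round (α * (d * Q + (r + 1) : ℕ)) - d * cfNum a (n + 1))).trans ?_
          have h3 : |-(d * (α * cfDen a (n + 1) - cfNum a (n + 1)))| =
              d * cfErr a α (n + 1) := by
            rw [abs_neg, abs_mul, abs_cfDen_mul_sub_cfNum hα, Nat.abs_cast]
          rw [← h3, nint]
          refine le_trans (le_of_eq ?_) (abs_add_le _ _)
          congr 1
          push_cast
          rw [← hQ]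
          ring
        have h4 : (2 * d : ℝ) ≤ a n := by exact_mod_cast h2d
        have h5 := cfErr_eq (a := a) (α := α) n
        nlinarith [hα (n + 2)]
    · refine ⟨cfErr a α (n + 1), hε, ?_, ?_⟩
      · have h1 := one_le_two_mul_cfErr ha hα (n + 1)
        have h2 : (cfDen a (n + 2) : ℝ) ≤ 4 * (d * Q) := by
          have h3 : cfDen a n ≤ Q := (cfDen_strictMono ha).monotone n.le_succ
          have h4 : a n * Q ≤ (2 * d) * Q := Nat.mul_le_mul_right _ (by omega)
          have h5 : 1 * Q ≤ d * Q := Nat.mul_le_mul_right _ hd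
          have h6 : cfDen a (n + 2) ≤ 4 * (d * Q) := by
            rw [cfDen_add_two, ← hQ]; nlinarith
          exact_mod_cast h6
        have : 1 / cfErr a α (n + 1) ≤ 8 * (d * Q) := by
          rw [div_le_iff₀ hε]
          nlinarith
        linarith
      · intro r hr
        rw [hS, Finset.mem_filter] at hr
        exact cfErr_le_nint hα (by omega) hr.2
  have hsum := sum_inv_nint_le (S := S) (x := fun r => α * (d * Q + (r + 1) : ℕ)) hδ hμ hM hμS (by
    have key : ∀ r ∈ S, ∀ s ∈ S, s < r →
        cfErr a α n ≤ nint (α * (d * Q + (r + 1) : ℕ) - α * (d * Q + (s + 1) : ℕ)) := by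
      intro r hr s hs hsr
      rw [hS, Finset.mem_filter, Finset.mem_range] at hr hs
      have h1 : cfErr a α n ≤ nint (α * (r - s : ℕ)) := cfErr_le_nint hα (by omega) (by omega)
      convert h1 using 2
      push_cast [hsr.le]
      ring
    intro r hr s hs hrs
    rcases lt_or_gt_of_ne hrs with h | h
    · refine (key s hs r hr h).trans ?_
      refine (nint_le_abs_sub_intCast _
        (-round (α * (d * Q + (r + 1) : ℕ) - α * (d * Q + (s + 1) : ℕ)))).trans_eq ?_
      rw [nint, ← abs_neg]
      push_cast
      congr 1
      ring
    · exact key r hr s hs h)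
  have hzero : (if d * Q + 0 < cfDen a (n + 2) then
      1 / (((d * Q + 0 : ℕ) : ℝ) * nint (α * (d * Q + 0 : ℕ))) else 0) ≤
      1 / (Q * cfErr a α (n + 1)) * (1 / (d : ℝ) ^ 2) := by
    split_ifs
    · rw [add_zero, mul_cfErr_eq_nint ha hα hda]
      apply le_of_eq
      push_cast
      field_simp
    · positivity
  have hrest : ∑ r ∈ Finset.range (Q - 1),
      (if d * Q + (r + 1) < cfDen a (n + 2) then
        1 / (((d * Q + (r + 1) : ℕ) : ℝ) * nint (α * (d * Q + (r + 1) : ℕ))) else 0) ≤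
      1 / (d * Q) * ∑ r ∈ S, 1 / nint (α * (d * Q + (r + 1) : ℕ)) := by
    rw [← Finset.sum_filter, Finset.mul_sum]
    refine Finset.sum_le_sum fun r hr => ?_
    rw [one_div_mul_one_div]
    have h1 := hμ.trans_le (hμS r hr)
    apply one_div_le_one_div_of_le (by positivity)
    gcongr
    push_cast
    have : (0 : ℝ) ≤ (r : ℝ) + 1 := by positivity
    linarith
  have hfinal : 1 / (d * Q) * (2 * (1 / μ + 1 / cfErr a α n * (1 + Real.log Q))) ≤
      24 + 4 * (1 + Real.log Q) * (1 / d) := by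
    have h1 : 1 / cfErr a α n ≤ 2 * Q := by rw [div_le_iff₀ hδ]; linarith
    calc 1 / (d * Q) * (2 * (1 / μ + 1 / cfErr a α n * (1 + Real.log Q)))
        ≤ 1 / (d * Q) * (2 * ((4 * Q + 8 * (d * Q)) + 2 * Q * (1 + Real.log Q))) := by gcongr
      _ = 8 * (1 / d) + 16 + 4 * (1 + Real.log Q) * (1 / d) := by field_simp; ring
      _ ≤ 24 + 4 * (1 + Real.log Q) * (1 / d) := by
        have : 1 / (d : ℝ) ≤ 1 := by rw [div_le_one (by positivity)]; exact hdR
        linarith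
  rw [show Finset.range Q = Finset.range (Q - 1 + 1) by rw [Nat.sub_add_cancel hQpos],
    Finset.sum_range_succ']
  have hmul : 1 / (d * Q) * ∑ r ∈ S, 1 / nint (α * (d * Q + (r + 1) : ℕ)) ≤
      1 / (d * Q) * (2 * (1 / μ + 1 / cfErr a α n * (1 + Real.log Q))) := by gcongr
  linarith

/-- The sum over the integers between two consecutive convergent denominators. -/
lemma sum_block_le (ha : ∀ n, 1 ≤ a n) (hα : ∀ n, 0 ≤ cfErr a α n) (n : ℕ) :
    ∑ k ∈ Finset.Ico (cfDen a (n + 1)) (cfDen a (n + 2)), 1 / ((k : ℝ) * nint (α * k)) ≤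
      32 * a n + 4 * (1 + Real.log (cfDen a (n + 1))) * (1 + Real.log (a n)) := by
  set Q := cfDen a (n + 1) with hQ
  have hQR : (0 : ℝ) < Q := by exact_mod_cast cfDen_pos (a := a) (n + 1)
  have hlog : 0 ≤ Real.log Q := Real.log_natCast_nonneg Q
  have hε := cfErr_pos ha hα (n + 1)
  have haR : (1 : ℝ) ≤ a n := by exact_mod_cast ha n
  have hnQ : cfDen a n ≤ Q := (cfDen_strictMono ha).monotone n.le_succ
  have hle : cfDen a (n + 2) ≤ (a n + 1) * Q := by
    rw [cfDen_add_two]; nlinarith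
  have hinv : 1 / (Q * cfErr a α (n + 1)) ≤ 4 * a n := by
    have h1 := one_le_two_mul_cfErr ha hα (n + 1)
    have h2 : (cfDen a (n + 2) : ℝ) ≤ (a n + 1) * Q := by exact_mod_cast hle
    rw [div_le_iff₀ (by positivity)]
    have h3 : (cfDen a (n + 2) : ℝ) ≤ 2 * a n * Q := by nlinarith
    nlinarith
  calc ∑ k ∈ Finset.Ico Q (cfDen a (n + 2)), 1 / ((k : ℝ) * nint (α * k))
      = ∑ k ∈ Finset.Ico Q (cfDen a (n + 2)),
          (if k < cfDen a (n + 2) then 1 / ((k : ℝ) * nint (α * k)) else 0) :=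
        Finset.sum_congr rfl fun k hk => (if_pos (Finset.mem_Ico.mp hk).2).symm
    _ ≤ ∑ k ∈ Finset.Ico Q ((a n + 1) * Q),
          (if k < cfDen a (n + 2) then 1 / ((k : ℝ) * nint (α * k)) else 0) := by
        refine Finset.sum_le_sum_of_subset_of_nonneg (Finset.Ico_subset_Ico_right hle) ?_
        intro k _ _
        have := nint_nonneg (α * k)
        split_ifs <;> positivity
    _ ≤ ∑ d ∈ Finset.Icc 1 (a n), (1 / (Q * cfErr a α (n + 1)) * (1 / (d : ℝ) ^ 2) + 24 +
        4 * (1 + Real.log Q) * (1 / d)) := by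
        rw [sum_Ico_mul_eq_sum_sum]
        refine Finset.sum_le_sum fun d hd => ?_
        rw [Finset.mem_Icc] at hd
        exact sum_block_row_le ha hα hd.1 hd.2
    _ = 1 / (Q * cfErr a α (n + 1)) * ∑ d ∈ Finset.Icc 1 (a n), 1 / (d : ℝ) ^ 2 + 24 * a n +
        4 * (1 + Real.log Q) * ∑ d ∈ Finset.Icc 1 (a n), 1 / (d : ℝ) := by
        rw [Finset.sum_add_distrib, Finset.sum_add_distrib, ← Finset.mul_sum, ← Finset.mul_sum,
          Finset.sum_const, Nat.card_Icc, nsmul_eq_mul]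
        simp [mul_comm]
    _ ≤ 4 * a n * 2 + 24 * a n + 4 * (1 + Real.log Q) * (1 + Real.log (a n)) := by
        gcongr
        · exact sum_Icc_inv_sq_le _
        · exact sum_Icc_inv_le _
    _ = _ := by ring

lemma sum_log_le_log_cfDen (ha : ∀ n, 1 ≤ a n) (m : ℕ) :
    ∑ n ∈ Finset.range m, Real.log (a n) ≤ Real.log (cfDen a (m + 1)) := by
  induction m with
  | zero => simpa using Real.log_natCast_nonneg (cfDen a 1)
  | succ m ih =>
    rw [Finset.sum_range_succ]
    have h1 : (0 : ℝ) < a m := by exact_mod_cast ha m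
    have h2 : (0 : ℝ) < cfDen a (m + 1) := by exact_mod_cast cfDen_pos (a := a) (m + 1)
    have h3 : Real.log (a m * cfDen a (m + 1)) ≤ Real.log (cfDen a (m + 2)) := by
      apply Real.log_le_log (by positivity)
      rw [cfDen_add_two]
      push_cast
      linarith [Nat.cast_nonneg (α := ℝ) (cfDen a m)]
    rw [Real.log_mul h1.ne' h2.ne'] at h3
    linarith

lemma sum_below_cfDen_le (ha : ∀ n, 1 ≤ a n) (hα : ∀ n, 0 ≤ cfErr a α n) (m : ℕ) :
    ∑ k ∈ Finset.Ico 2 (cfDen a (m + 1)), 1 / ((k : ℝ) * nint (α * k)) ≤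
      32 * ∑ n ∈ Finset.range m, (a n : ℝ) +
        4 * (1 + Real.log (cfDen a (m + 1))) * (m + Real.log (cfDen a (m + 1))) := by
  have h : ∀ m, ∑ k ∈ Finset.Ico 2 (cfDen a (m + 1)), 1 / ((k : ℝ) * nint (α * k)) ≤
      ∑ n ∈ Finset.range m,
        (32 * a n + 4 * (1 + Real.log (cfDen a (n + 1))) * (1 + Real.log (a n))) := by
    intro m
    induction m with
    | zero => simp [cfDen]
    | succ m ih =>
      rw [Finset.sum_range_succ, ← Finset.sum_Ico_consecutive _
        (show 2 ≤ cfDen a (m + 1) from (cfDen_strictMono ha).monotone (show 1 ≤ m + 1 by omega))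
        (show cfDen a (m + 1) ≤ cfDen a (m + 1 + 1) from
          (cfDen_strictMono ha).monotone (m + 1).le_succ)]
      exact add_le_add ih (sum_block_le ha hα m)
  have hlog : 0 ≤ Real.log (cfDen a (m + 1)) := Real.log_natCast_nonneg _
  calc _ ≤ _ := h m
    _ ≤ ∑ n ∈ Finset.range m,
        (32 * (a n : ℝ) + 4 * (1 + Real.log (cfDen a (m + 1))) * (1 + Real.log (a n))) := by
        refine Finset.sum_le_sum fun n hn => ?_
        have h1 : 0 ≤ Real.log (a n) := Real.log_natCast_nonneg _
        have h2 : (0 : ℝ) < cfDen a (n + 1) := by exact_mod_cast cfDen_pos (a := a) (n + 1)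
        have h3 : cfDen a (n + 1) ≤ cfDen a (m + 1) :=
          (cfDen_strictMono ha).monotone (by have := Finset.mem_range.mp hn; omega)
        gcongr
    _ = 32 * ∑ n ∈ Finset.range m, (a n : ℝ) + 4 * (1 + Real.log (cfDen a (m + 1))) *
        (m + ∑ n ∈ Finset.range m, Real.log (a n)) := by
        rw [Finset.sum_add_distrib, ← Finset.mul_sum, ← Finset.mul_sum, Finset.sum_add_distrib]
        simp
    _ ≤ _ := by
        gcongr
        exact sum_log_le_log_cfDen ha m

lemma two_pow_le_cfDen_sq (ha : ∀ n, 1 ≤ a n) (n : ℕ) : 2 ^ n ≤ cfDen a n ^ 2 := by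
  induction n using Nat.twoStepInduction with
  | zero => simp [cfDen]
  | one => simp [cfDen]
  | more n h1 _ =>
    have h2 : 2 * cfDen a n ≤ cfDen a (n + 2) := by
      have : cfDen a n < cfDen a (n + 1) := cfDen_strictMono ha n.lt_succ_self
      have := Nat.mul_le_mul_right (cfDen a (n + 1)) (ha n)
      rw [cfDen_add_two]
      omega
    calc 2 ^ (n + 2) = 4 * 2 ^ n := by ring
      _ ≤ 4 * cfDen a n ^ 2 := by gcongr
      _ = (2 * cfDen a n) ^ 2 := by ring
      _ ≤ cfDen a (n + 2) ^ 2 := by gcongr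

end ContinuedFraction

/-- The rule for the partial quotients: `(log₂ v) ^ 2` if that is at least the sum `s` of the
previous ones, and `1` otherwise. -/
def spike (v s : ℕ) : ℕ := if s ≤ Nat.log 2 v ^ 2 then Nat.log 2 v ^ 2 else 1

/-- Two consecutive denominators and the sum of the partial quotients used so far. -/
def spikeState : ℕ → ℕ × ℕ × ℕ
  | 0 => (1, 2, 0)
  | n + 1 =>
    let t := spikeState n
    (t.2.1, spike t.2.1 t.2.2 * t.2.1 + t.1, t.2.2 + spike t.2.1 t.2.2)

lemma exists_spike_quotients : ∃ a : ℕ → ℕ,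
    ∀ n, a n = spike (cfDen a (n + 1)) (∑ j ∈ Finset.range n, a j) := by
  set a : ℕ → ℕ := fun n => spike (spikeState n).2.1 (spikeState n).2.2 with ha
  have h : ∀ n, spikeState n = (cfDen a n, cfDen a (n + 1), ∑ j ∈ Finset.range n, a j) := by
    intro n
    induction n with
    | zero => simp [spikeState, cfDen]
    | succ n ih =>
      have han : a n = spike (cfDen a (n + 1)) (∑ j ∈ Finset.range n, a j) := by
        simp only [ha]; rw [ih]
      rw [spikeState, ih, Finset.sum_range_succ, cfDen_add_two, han]
  refine ⟨a, fun n => ?_⟩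
  conv_lhs => simp only [ha]
  rw [h n]

section Spike

variable {a : ℕ → ℕ}

lemma one_le_of_spike (ha : ∀ n, a n = spike (cfDen a (n + 1)) (∑ j ∈ Finset.range n, a j))
    (n : ℕ) : 1 ≤ a n := by
  have hlog : ∀ n, 2 ≤ cfDen a (n + 1) := by
    intro n
    induction n using Nat.strong_induction_on with
    | _ n ih =>
      cases n with
      | zero => simp [cfDen]
      | succ n =>
        have h1 : 1 ≤ a n := by
          rw [ha, spike]
          split_ifs
          · exact Nat.one_le_pow _ _ (Nat.log_pos one_lt_two (ih n n.lt_succ_self))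
          · exact le_rfl
        have := ih n n.lt_succ_self
        rw [cfDen_add_two]
        nlinarith
  rw [ha, spike]
  split_ifs
  · exact Nat.one_le_pow _ _ (Nat.log_pos one_lt_two (hlog n))
  · exact le_rfl

lemma sum_spike_le (ha : ∀ n, a n = spike (cfDen a (n + 1)) (∑ j ∈ Finset.range n, a j)) (n : ℕ) :
    ∑ j ∈ Finset.range n, a j ≤ 2 * Nat.log 2 (cfDen a n) ^ 2 + n := by
  induction n with
  | zero => simp
  | succ n ih =>
    have hmono : Nat.log 2 (cfDen a n) ≤ Nat.log 2 (cfDen a (n + 1)) :=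
      Nat.log_mono_right ((cfDen_strictMono (one_le_of_spike ha)).monotone n.le_succ)
    have hsq := Nat.pow_le_pow_left hmono 2
    rw [Finset.sum_range_succ, ha n, spike]
    split_ifs with h <;> omega

lemma exists_large_spike (ha : ∀ n, a n = spike (cfDen a (n + 1)) (∑ j ∈ Finset.range n, a j))
    (M : ℕ) : ∃ n, M ≤ n ∧ a n = Nat.log 2 (cfDen a (n + 1)) ^ 2 := by
  by_contra! hcon
  have hlt : ∀ n, M ≤ n → Nat.log 2 (cfDen a (n + 1)) ^ 2 < ∑ j ∈ Finset.range n, a j := by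
    intro n hn
    by_contra! hle
    exact hcon n hn (by rw [ha n, spike, if_pos hle])
  have hsum : ∀ k, ∑ j ∈ Finset.range (M + k), a j = ∑ j ∈ Finset.range M, a j + k := by
    intro k
    induction k with
    | zero => simp
    | succ k ih =>
      rw [← add_assoc, Finset.sum_range_succ, ih, ha (M + k), spike,
        if_neg (not_le.mpr (hlt (M + k) (by omega)))]
      ring
  set s := ∑ j ∈ Finset.range M, a j with hs
  have h1 := hlt (M + (s + 8)) (by omega)
  rw [hsum] at h1
  have h2 := two_pow_le_cfDen_sq (one_le_of_spike ha) (M + (s + 8) + 1)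
  set l := Nat.log 2 (cfDen a (M + (s + 8) + 1)) with hl
  have h3 : cfDen a (M + (s + 8) + 1) < 2 ^ (l + 1) := Nat.lt_pow_succ_log_self one_lt_two _
  have h4 : 2 ^ (M + (s + 8) + 1) < 2 ^ (2 * (l + 1)) := by
    refine h2.trans_lt ?_
    rw [mul_comm 2, pow_mul]
    exact Nat.pow_lt_pow_left h3 two_ne_zero
  have h5 := (Nat.pow_lt_pow_iff_right one_lt_two).mp h4
  nlinarith

lemma sum_below_two_pow_le
    (ha : ∀ n, a n = spike (cfDen a (n + 1)) (∑ j ∈ Finset.range n, a j)) {α : ℝ}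
    (hα : ∀ n, 0 ≤ cfErr a α n) {K : ℕ} (hK : 1 ≤ K) :
    ∑ k ∈ Finset.Ico (2 : ℕ) (2 ^ K), 1 / ((k : ℝ) * nint (α * k)) ≤ 248 * (K : ℝ) ^ 2 := by
  have ha1 := one_le_of_spike ha
  have hmono := cfDen_strictMono ha1
  have hex : ∃ m, 2 ^ K ≤ cfDen a (m + 1) :=
    ⟨2 ^ K, (Nat.le_succ _).trans hmono.le_apply⟩
  set m := Nat.find hex with hm
  have hm1 : 2 ^ K ≤ cfDen a (m + 1) := Nat.find_spec hex
  have hKR : (1 : ℝ) ≤ K := by exact_mod_cast hK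
  have hsub : ∑ k ∈ Finset.Ico (2 : ℕ) (2 ^ K), 1 / ((k : ℝ) * nint (α * k)) ≤
      ∑ k ∈ Finset.Ico 2 (cfDen a (m + 1)), 1 / ((k : ℝ) * nint (α * k)) := by
    refine Finset.sum_le_sum_of_subset_of_nonneg (Finset.Ico_subset_Ico_right hm1) ?_
    intro k _ _
    have := nint_nonneg (α * k)
    positivity
  refine hsub.trans ?_
  rcases Nat.eq_zero_or_eq_succ_pred m with h0 | h0
  · rw [h0]
    simp only [cfDen, Finset.Ico_self, Finset.sum_empty]
    positivity
  set j := m.pred with hj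
  have hj1 : cfDen a m < 2 ^ K := by
    rw [h0]
    exact not_le.mp (Nat.find_min hex (by omega))
  have hlogm : Nat.log 2 (cfDen a m) < K := Nat.log_lt_of_lt_pow (cfDen_pos m).ne' hj1
  have hmK : m < 2 * K := by
    have h1 : 2 ^ m < 2 ^ (2 * K) := by
      refine (two_pow_le_cfDen_sq ha1 m).trans_lt ?_
      rw [mul_comm 2, pow_mul]
      exact Nat.pow_lt_pow_left hj1 two_ne_zero
    exact (Nat.pow_lt_pow_iff_right one_lt_two).mp h1
  have haj : a j ≤ K ^ 2 := by
    rw [ha, spike, ← Nat.succ_eq_add_one, ← h0]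
    split_ifs
    · exact Nat.pow_le_pow_left hlogm.le 2
    · exact Nat.one_le_pow _ _ hK
  have hden : cfDen a (m + 1) ≤ 2 ^ (4 * K) := by
    have h1 : cfDen a (m + 1) = a j * cfDen a m + cfDen a j := by
      rw [h0]; exact cfDen_add_two j
    have h2 : cfDen a j ≤ 2 ^ K := (hmono.monotone (by omega : j ≤ m)).trans hj1.le
    have h3 : K < 2 ^ K := Nat.lt_two_pow_self
    have h4 : 2 ≤ 2 ^ K := by
      calc 2 = 2 ^ 1 := by norm_num
        _ ≤ 2 ^ K := Nat.pow_le_pow_right two_pos hK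
    calc cfDen a (m + 1) ≤ (2 ^ K) ^ 2 * 2 ^ K + 2 ^ K := by
          rw [h1]
          gcongr
          exact haj.trans (Nat.pow_le_pow_left h3.le 2)
      _ ≤ (2 ^ K) ^ 4 := by
          have h5 : 2 ^ K ≤ (2 ^ K) ^ 2 * 2 ^ K := Nat.le_mul_of_pos_left _ (by positivity)
          have h6 : 2 * ((2 ^ K) ^ 2 * 2 ^ K) ≤ 2 ^ K * ((2 ^ K) ^ 2 * 2 ^ K) :=
            Nat.mul_le_mul_right _ h4
          calc (2 ^ K) ^ 2 * 2 ^ K + 2 ^ K ≤ 2 ^ K * ((2 ^ K) ^ 2 * 2 ^ K) := by linarith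
            _ = (2 ^ K) ^ 4 := by ring
      _ = 2 ^ (4 * K) := by rw [← pow_mul]; ring_nf
  have hlog : Real.log (cfDen a (m + 1)) ≤ 4 * K := by
    have hpos : (0 : ℝ) < cfDen a (m + 1) := by exact_mod_cast cfDen_pos (a := a) (m + 1)
    have h1 : (cfDen a (m + 1) : ℝ) ≤ 2 ^ (4 * K) := by exact_mod_cast hden
    have h2 := Real.log_le_log hpos h1
    rw [Real.log_pow] at h2
    have h3 : Real.log 2 ≤ 1 := by linarith [Real.log_two_lt_d9]
    push_cast at h2
    nlinarith
  have hlog0 : 0 ≤ Real.log (cfDen a (m + 1)) := Real.log_natCast_nonneg _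
  have hsum : (∑ n ∈ Finset.range m, (a n : ℝ)) ≤ 4 * (K : ℝ) ^ 2 := by
    have h1 := sum_spike_le ha m
    have h2 := Nat.pow_le_pow_left hlogm.le 2
    have h3 : ∑ n ∈ Finset.range m, a n ≤ 4 * K ^ 2 := by nlinarith
    exact_mod_cast h3
  have hmKR : (m : ℝ) ≤ 2 * K := by exact_mod_cast hmK.le
  calc _ ≤ _ := sum_below_cfDen_le ha1 hα m
    _ ≤ 32 * (4 * (K : ℝ) ^ 2) + 4 * (K + 4 * K) * (2 * K + 4 * K) := by gcongr
    _ = 248 * (K : ℝ) ^ 2 := by ring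

end Spike

/-- There is `α` for which the sums of `1 / (q ‖α q‖)` grow like the square of the logarithm,
although `q (log₂ q) ^ 2 ‖α q‖` is bounded along a sequence. -/
theorem exists_sum_le_and_frequently_le : ∃ α : ℝ, (∀ q : ℕ, 0 < q → 0 < nint (α * q)) ∧
    (∀ K : ℕ, 1 ≤ K →
      ∑ q ∈ Finset.Ico (2 : ℕ) (2 ^ K), 1 / ((q : ℝ) * nint (α * q)) ≤ 248 * (K : ℝ) ^ 2) ∧
    ∀ M : ℕ, ∃ q, M ≤ q ∧ (q : ℝ) * Real.logb 2 q ^ 2 * nint (α * q) ≤ 4 := by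
  obtain ⟨a, ha⟩ := exists_spike_quotients
  obtain ⟨α, hα⟩ := exists_between_convergents a
  change ∀ n, 0 ≤ cfErr a α n at hα
  have ha1 := one_le_of_spike ha
  have hmono := cfDen_strictMono ha1
  refine ⟨α, fun q hq => ?_, fun K hK => sum_below_two_pow_le ha hα hK, fun M => ?_⟩
  · exact (cfErr_pos ha1 hα q).trans_le (cfErr_le_nint hα hq (Nat.lt_of_succ_le hmono.le_apply))
  obtain ⟨n, hn, han⟩ := exists_large_spike ha M
  set q := cfDen a (n + 1) with hq
  refine ⟨q, hn.trans (n.le_succ.trans hmono.le_apply), ?_⟩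
  have hq2 : 2 ≤ q := hmono.monotone (show 1 ≤ n + 1 by omega)
  have hqR : (0 : ℝ) < q := by positivity
  set l := Nat.log 2 q with hl
  have hl1 : (1 : ℝ) ≤ l := by exact_mod_cast Nat.log_pos one_lt_two hq2
  have hlogb : Real.logb 2 q ≤ l + 1 := by
    rw [Real.logb_le_iff_le_rpow one_lt_two hqR]
    have h1 : q < 2 ^ (l + 1) := Nat.lt_pow_succ_log_self one_lt_two q
    have h2 : (q : ℝ) ≤ 2 ^ (l + 1) := by exact_mod_cast h1.le
    exact_mod_cast h2
  have hlogb0 : 0 ≤ Real.logb 2 q := Real.logb_nonneg one_lt_two (by exact_mod_cast (by omega))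
  have herr : nint (α * q) ≤ cfErr a α (n + 1) :=
    (nint_le_abs_sub_intCast _ _).trans_eq (abs_cfDen_mul_sub_cfNum hα (n + 1))
  have hε := hα (n + 1)
  have hprod : cfErr a α (n + 1) * ((l : ℝ) ^ 2 * q) ≤ 1 := by
    refine le_trans ?_ (cfErr_mul_cfDen_le hα (n + 1))
    gcongr
    rw [cfDen_add_two, han]
    push_cast
    linarith [Nat.cast_nonneg (α := ℝ) (cfDen a n)]
  calc (q : ℝ) * Real.logb 2 q ^ 2 * nint (α * q)
      ≤ q * (l + 1) ^ 2 * cfErr a α (n + 1) := by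
        have := nint_nonneg (α * q)
        gcongr
    _ ≤ q * (l + l) ^ 2 * cfErr a α (n + 1) := by gcongr
    _ = 4 * (cfErr a α (n + 1) * ((l : ℝ) ^ 2 * q)) := by ring
    _ ≤ 4 := by linarith

theorem exists_badly_approximable_pair_littlewood :
    ∃ α β : ℝ,
      0 < Filter.liminf
        (fun q : ℕ => (q : ℝ) * (Real.logb 2 q) ^ 2 * nint (α * q) * nint (β * q))
        Filter.atTop := by
  obtain ⟨α, hpos, hsum, hfreq⟩ := exists_sum_le_and_frequently_le
  set c : ℝ := 1 / 214272 with hc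
  set N : ℕ → ℕ := fun i => 2 ^ 3 ^ (i + 2) with hN
  set Δ : ℕ → ℝ := fun q => c / (q * Real.logb 2 q ^ 2 * nint (α * q)) + 1 / (q : ℝ) ^ 2 with hΔ
  obtain ⟨β, hβ⟩ := exists_forall_le_nint (Δ := Δ) (N := N) (by norm_num [hN])
    (fun i => by simp only [hN]; rw [← pow_mul]; congr 1)
    (fun q => by
      have := nint_nonneg (α * q)
      simp only [hΔ, hc]
      have : 0 ≤ 1 / 214272 / (q * Real.logb 2 q ^ 2 * nint (α * q)) := by positivity
      linarith)
    (fun i => by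
      set k := 3 ^ (i + 2) with hk
      have hk9 : 9 ≤ k := by
        calc 9 = 3 ^ 2 := by norm_num
          _ ≤ k := Nat.pow_le_pow_right (by norm_num) (by omega)
      have hkR : (9 : ℝ) ≤ k := by exact_mod_cast hk9
      have hNi : N i = 2 ^ k := rfl
      have hNi' : N (i + 1) = 2 ^ (3 * k) := by
        simp only [hN, hk]; congr 1; ring
      have hN2 : 2 ≤ N i := by
        rw [hNi]; calc 2 = 2 ^ 1 := by norm_num
          _ ≤ 2 ^ k := Nat.pow_le_pow_right two_pos (by omega)
      simp only [hΔ]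
      rw [Finset.sum_add_distrib]
      have h1 : ∑ q ∈ Finset.Ico (N i) (N (i + 1)), 1 / (q : ℝ) ^ 2 ≤ 2 / 512 := by
        refine (sum_Ico_inv_sq_le (zero_lt_two.trans_le hN2) _).trans ?_
        have : 2 ^ 9 ≤ N i := by rw [hNi]; exact Nat.pow_le_pow_right two_pos hk9
        have : (512 : ℝ) ≤ N i := by exact_mod_cast this
        gcongr
      have h2 : ∑ q ∈ Finset.Ico (N i) (N (i + 1)),
          c / (q * Real.logb 2 q ^ 2 * nint (α * q)) ≤ 1 / 96 := by
        calc _ ≤ ∑ q ∈ Finset.Ico (N i) (N (i + 1)),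
              c / (k : ℝ) ^ 2 * (1 / ((q : ℝ) * nint (α * q))) := by
              refine Finset.sum_le_sum fun q hq => ?_
              have hNq : N i ≤ q := (Finset.mem_Ico.mp hq).1
              have hq0 : 0 < q := by omega
              have hqR : (0 : ℝ) < q := by exact_mod_cast hq0
              have hq1 := hpos q hq0
              have hlog : (k : ℝ) ≤ Real.logb 2 q := by
                rw [Real.le_logb_iff_rpow_le one_lt_two hqR, Real.rpow_natCast]
                rw [hNi] at hNq
                exact_mod_cast hNq
              rw [div_mul_div_comm, mul_one]
              apply div_le_div_of_nonneg_left (by norm_num [hc]) (by positivity)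
              calc (k : ℝ) ^ 2 * (q * nint (α * q))
                  ≤ Real.logb 2 q ^ 2 * (q * nint (α * q)) := by gcongr
                _ = _ := by ring
          _ = c / (k : ℝ) ^ 2 * ∑ q ∈ Finset.Ico (N i) (N (i + 1)),
              1 / ((q : ℝ) * nint (α * q)) := by rw [Finset.mul_sum]
          _ ≤ c / (k : ℝ) ^ 2 * (248 * ((3 * k : ℕ) : ℝ) ^ 2) := by
              have hcpos : 0 < c := by norm_num [hc]
              gcongr
              refine le_trans ?_ (hsum (3 * k) (by omega))
              rw [hNi']
              refine Finset.sum_le_sum_of_subset_of_nonneg (Finset.Ico_subset_Ico_left hN2) ?_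
              intro q _ _
              have := nint_nonneg (α * q)
              positivity
          _ = 1 / 96 := by
              rw [hc]; push_cast; field_simp; norm_num
      linarith)
  refine ⟨α, β, lt_of_lt_of_le (show 0 < c by norm_num [hc]) ?_⟩
  refine Filter.le_liminf_of_le (Filter.IsCoboundedUnder.of_frequently_le (a := (4 : ℝ)) ?_) ?_
  · rw [Filter.frequently_atTop]
    intro M
    obtain ⟨q, hMq, hq⟩ := hfreq M
    refine ⟨q, hMq, ?_⟩
    have h1 := nint_le_half (β * q)
    have h2 := nint_nonneg (β * q)
    have h3 := nint_nonneg (α * q)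
    calc _ ≤ (q : ℝ) * Real.logb 2 q ^ 2 * nint (α * q) * 1 := by gcongr; linarith
      _ ≤ 4 := by linarith
  · filter_upwards [Filter.eventually_ge_atTop (N 0)] with q hq
    have hN2 : 2 ≤ N 0 := by norm_num [hN]
    have hq2 : 2 ≤ q := hN2.trans hq
    have hqR : (1 : ℝ) < q := by exact_mod_cast hq2
    have hlog : 0 < Real.logb 2 q := Real.logb_pos one_lt_two hqR
    have hα := hpos q (by omega)
    have hle : c / (q * Real.logb 2 q ^ 2 * nint (α * q)) ≤ nint (β * q) := by
      refine le_trans ?_ (hβ q hq)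
      simp only [hΔ]
      have : 0 ≤ 1 / (q : ℝ) ^ 2 := by positivity
      linarith
    rw [div_le_iff₀ (by positivity)] at hle
    linarith
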